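/- arXiv:math/0006179 — 8 statements merged into one kernel-verified Lean document; each statement's English description precedes it below -/
import Mathlib

section
/- For every F : ℝ → ℝ → ℤ → ℂ, every r ∈ ℝ, every m ∈ ℤ, and every ξ ∈ ℝ with |ξ| ≤ q⁻¹, one has (X⁻(X⁺F))(r,ξ,m) − (X⁺(X⁻F))(r,ξ,m) = λ·(X³(X³F))(r,ξ,m), i.e. X⁻X⁺ − X⁺X⁻ = λ X³X³ on the region |ξ| ≤ q⁻¹. -/
/-- `X³` acting on Fourier modes `F(r, ξ, m)`: multiplication by `r·ξ`. -/
noncomputable def X3op (F : ℝ → ℝ → ℤ → ℂ) : ℝ → ℝ → ℤ → ℂ :=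
  fun r ξ m => ((r * ξ : ℝ) : ℂ) * F r ξ m

/-- `X⁺` acting on Fourier modes. -/
noncomputable def Xpop (q : ℝ) (F : ℝ → ℝ → ℤ → ℂ) : ℝ → ℝ → ℤ → ℂ :=
  fun r ξ m =>
    ((-(r / q) * Real.sqrt ((1 - q⁻¹ ^ 2 * ξ ^ 2) / (1 + q⁻¹ ^ 2)) : ℝ) : ℂ) *
      F r (q⁻¹ ^ 2 * ξ) (m - 1)

/-- `X⁻` acting on Fourier modes. -/
noncomputable def Xmop (q : ℝ) (F : ℝ → ℝ → ℤ → ℂ) : ℝ → ℝ → ℤ → ℂ :=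
  fun r ξ m =>
    ((q * r * Real.sqrt ((1 - q ^ 2 * ξ ^ 2) / (1 + q ^ 2)) : ℝ) : ℂ) *
      F r (q ^ 2 * ξ) (m + 1)

/-- The normalising factors of `X⁺` and `X⁻` combine to `q + q⁻¹`. -/
theorem sqrt_div_mul_sqrt_div_inv {q a : ℝ} (hq : 0 < q) (ha : 0 ≤ a) :
    Real.sqrt (a / (1 + q ^ 2)) * Real.sqrt (a / (1 + q⁻¹ ^ 2)) = a / (q + q⁻¹) := by
  rw [← Real.sqrt_mul (by positivity), Real.sqrt_eq_iff_mul_self_eq (by positivity) (by positivity)]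
  field_simp
  ring

/-- `X⁻X⁺ − X⁺X⁻ = λ X³X³` on the region `|ξ| ≤ q⁻¹`, where `λ = q − q⁻¹`. -/
theorem Xm_Xp_commutator (q : ℝ) (hq : 1 < q) (F : ℝ → ℝ → ℤ → ℂ) (r : ℝ) (m : ℤ)
    (ξ : ℝ) (hξ : |ξ| ≤ q⁻¹) :
    Xmop q (Xpop q F) r ξ m - Xpop q (Xmop q F) r ξ m =
      ((q - q⁻¹ : ℝ) : ℂ) * X3op (X3op F) r ξ m := by
  have hq0 : 0 < q := by linarith
  have hqξ : q ^ 2 * ξ ^ 2 ≤ 1 := by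
    have h : |q * ξ| ≤ 1 := by
      rw [abs_mul, abs_of_pos hq0]
      calc q * |ξ| ≤ q * q⁻¹ := by gcongr
        _ = 1 := mul_inv_cancel₀ hq0.ne'
    rw [← mul_pow]
    exact (sq_le_one_iff_abs_le_one _).2 h
  have hqinvξ : q⁻¹ ^ 2 * ξ ^ 2 ≤ 1 := by
    refine le_trans ?_ hqξ
    have : q⁻¹ ≤ q := (inv_le_one_of_one_le₀ hq.le).trans hq.le
    gcongr
  have hmp := sqrt_div_mul_sqrt_div_inv hq0 (sub_nonneg.2 hqξ)
  have hpm := sqrt_div_mul_sqrt_div_inv hq0 (sub_nonneg.2 hqinvξ)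
  have e₁ : q⁻¹ ^ 2 * (q ^ 2 * ξ) = ξ := by field_simp
  have e₂ : q ^ 2 * (q⁻¹ ^ 2 * ξ) = ξ := by field_simp
  have e₃ : q⁻¹ ^ 2 * (q ^ 2 * ξ) ^ 2 = q ^ 2 * ξ ^ 2 := by field_simp
  have e₄ : q ^ 2 * (q⁻¹ ^ 2 * ξ) ^ 2 = q⁻¹ ^ 2 * ξ ^ 2 := by field_simp
  simp only [Xmop, Xpop, X3op, e₁, e₂, e₃, e₄, add_sub_cancel_right, sub_add_cancel]
  simp only [← mul_assoc, ← Complex.ofReal_mul, ← sub_mul, ← Complex.ofReal_sub]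
  congr 2
  calc _ = (q * (r / q)) * (r * (Real.sqrt ((1 - q⁻¹ ^ 2 * ξ ^ 2) / (1 + q ^ 2)) *
            Real.sqrt ((1 - q⁻¹ ^ 2 * ξ ^ 2) / (1 + q⁻¹ ^ 2))) -
          r * (Real.sqrt ((1 - q ^ 2 * ξ ^ 2) / (1 + q ^ 2)) *
            Real.sqrt ((1 - q ^ 2 * ξ ^ 2) / (1 + q⁻¹ ^ 2)))) := by ring
    _ = _ := by
      rw [hmp, hpm]
      field_simp
      ring
end

section
/- The invariant length R² = X³X³ − qX⁺X⁻ − q⁻¹X⁻X⁺ is realized as multiplication by r²: for every F : ℝ → ℝ → ℤ → ℂ, every r ∈ ℝ, every m ∈ ℤ, and every ξ ∈ ℝ with |ξ| ≤ q⁻¹, one has (X³(X³F))(r,ξ,m) − q·(X⁺(X⁻F))(r,ξ,m) − q⁻¹·(X⁻(X⁺F))(r,ξ,m) = r²·F(r,ξ,m). -/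
/-- The two normalising factors `1 + q⁻²` and `1 + q²` multiply to `(q + q⁻¹)²`. -/
theorem sqrt_div_one_add_inv_sq_mul_sqrt_div_one_add_sq {q a : ℝ} (hq : 0 < q) (ha : 0 ≤ a) :
    Real.sqrt (a / (1 + q⁻¹ ^ 2)) * Real.sqrt (a / (1 + q ^ 2)) = q * a / (1 + q ^ 2) := by
  have h : a / (1 + q⁻¹ ^ 2) = q ^ 2 * (a / (1 + q ^ 2)) := by
    field_simp
    ring
  rw [h, Real.sqrt_mul (sq_nonneg q), Real.sqrt_sq hq.le, mul_assoc,
    Real.mul_self_sqrt (by positivity), mul_div_assoc]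

/-- On the region `|ξ| ≤ q`, `X⁺X⁻` is a multiplication operator. -/
theorem Xpop_Xmop_apply {q : ℝ} (hq : 0 < q) (F : ℝ → ℝ → ℤ → ℂ) (r : ℝ) (m : ℤ) {ξ : ℝ}
    (hξ : |ξ| ≤ q) :
    Xpop q (Xmop q F) r ξ m
      = ((-(r ^ 2 * (q * (1 - q⁻¹ ^ 2 * ξ ^ 2) / (1 + q ^ 2))) : ℝ) : ℂ) * F r ξ m := by
  have ha : 0 ≤ 1 - q⁻¹ ^ 2 * ξ ^ 2 := by
    have h : ξ ^ 2 ≤ q ^ 2 := sq_le_sq' (abs_le.mp hξ).1 (abs_le.mp hξ).2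
    have h' : q⁻¹ ^ 2 * ξ ^ 2 ≤ q⁻¹ ^ 2 * q ^ 2 := by gcongr
    rw [← mul_pow q⁻¹ q, inv_mul_cancel₀ hq.ne', one_pow] at h'
    linarith
  have harg : q ^ 2 * (q⁻¹ ^ 2 * ξ) ^ 2 = q⁻¹ ^ 2 * ξ ^ 2 := by field_simp
  have hξ' : q ^ 2 * (q⁻¹ ^ 2 * ξ) = ξ := by field_simp
  simp only [Xpop, Xmop]
  rw [harg, hξ', sub_add_cancel, ← mul_assoc, ← Complex.ofReal_mul,
    ← sqrt_div_one_add_inv_sq_mul_sqrt_div_one_add_sq hq ha]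
  congr 2
  field_simp

/-- On the region `|ξ| ≤ q⁻¹`, `X⁻X⁺` is a multiplication operator. -/
theorem Xmop_Xpop_apply {q : ℝ} (hq : 0 < q) (F : ℝ → ℝ → ℤ → ℂ) (r : ℝ) (m : ℤ) {ξ : ℝ}
    (hξ : |ξ| ≤ q⁻¹) :
    Xmop q (Xpop q F) r ξ m
      = ((-(r ^ 2 * (q * (1 - q ^ 2 * ξ ^ 2) / (1 + q ^ 2))) : ℝ) : ℂ) * F r ξ m := by
  have ha : 0 ≤ 1 - q ^ 2 * ξ ^ 2 := by
    have h : ξ ^ 2 ≤ q⁻¹ ^ 2 := sq_le_sq' (abs_le.mp hξ).1 (abs_le.mp hξ).2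
    have h' : q ^ 2 * ξ ^ 2 ≤ q ^ 2 * q⁻¹ ^ 2 := by gcongr
    rw [← mul_pow q q⁻¹, mul_inv_cancel₀ hq.ne', one_pow] at h'
    linarith
  have harg : q⁻¹ ^ 2 * (q ^ 2 * ξ) ^ 2 = q ^ 2 * ξ ^ 2 := by field_simp
  have hξ' : q⁻¹ ^ 2 * (q ^ 2 * ξ) = ξ := by field_simp
  simp only [Xpop, Xmop]
  rw [harg, hξ', add_sub_cancel_right, ← mul_assoc, ← Complex.ofReal_mul,
    ← sqrt_div_one_add_inv_sq_mul_sqrt_div_one_add_sq hq ha]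
  congr 2
  field_simp

/-- The invariant length `R² = X³X³ − qX⁺X⁻ − q⁻¹X⁻X⁺` is multiplication by `r²`
on the region `|ξ| ≤ q⁻¹`. -/
theorem invariant_length (q : ℝ) (hq : 1 < q) (F : ℝ → ℝ → ℤ → ℂ) (r : ℝ) (m : ℤ)
    (ξ : ℝ) (hξ : |ξ| ≤ q⁻¹) :
    X3op (X3op F) r ξ m - (q : ℂ) * Xpop q (Xmop q F) r ξ m
        - ((q⁻¹ : ℝ) : ℂ) * Xmop q (Xpop q F) r ξ m
      = ((r ^ 2 : ℝ) : ℂ) * F r ξ m := by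
  have hq0 : 0 < q := one_pos.trans hq
  have hξ' : |ξ| ≤ q := hξ.trans ((inv_le_one_of_one_le₀ hq.le).trans hq.le)
  rw [Xpop_Xmop_apply hq0 F r m hξ', Xmop_Xpop_apply hq0 F r m hξ]
  simp only [X3op]
  simp only [← mul_assoc, ← Complex.ofReal_mul, ← sub_mul, ← Complex.ofReal_sub]
  congr 2
  field_simp
  ring
end

section
/- Let q > 1 be real and λ = q − q⁻¹. If φ : ℝ → ℂ is continuous at 0 and satisfies the q-difference equation φ(x) − φ(q⁻²x) = λ·x² for all x ∈ ℝ, then φ(x) = φ(0) + (q³/(1+q²))·x² for all x ∈ ℝ. -/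
open Filter Topology in
/-- A function continuous at `0` and invariant under a contraction `x ↦ r * x` is constant. -/
theorem eq_apply_zero_of_forall_apply_mul_eq {ψ : ℝ → ℂ} {r : ℝ} (hr0 : 0 ≤ r) (hr1 : r < 1)
    (hcont : ContinuousAt ψ 0) (hinv : ∀ x, ψ (r * x) = ψ x) (x : ℝ) : ψ x = ψ 0 := by
  have hpow : ∀ n : ℕ, ψ (r ^ n * x) = ψ x := by
    intro n
    induction n with
    | zero => simp
    | succ n ih => rw [pow_succ', mul_assoc, hinv, ih]
  have hlim : Tendsto (fun n : ℕ => r ^ n * x) atTop (𝓝 0) := by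
    simpa using (tendsto_pow_atTop_nhds_zero_of_lt_one hr0 hr1).mul_const x
  have hψ : Tendsto (fun n : ℕ => ψ (r ^ n * x)) atTop (𝓝 (ψ 0)) := hcont.tendsto.comp hlim
  simp only [hpow] at hψ
  exact tendsto_nhds_unique tendsto_const_nhds hψ


/-- If `φ : ℝ → ℂ` is continuous at `0` and satisfies the q-difference equation
`φ(x) − φ(q⁻²x) = λ·x²` with `λ = q − q⁻¹`, then `φ(x) = φ(0) + (q³/(1+q²))·x²`. -/
theorem q_difference_solution (q : ℝ) (hq : 1 < q) (φ : ℝ → ℂ)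
    (hcont : ContinuousAt φ 0)
    (hrec : ∀ x : ℝ, φ x - φ (q⁻¹ ^ 2 * x) = ((q - q⁻¹ : ℝ) : ℂ) * (x : ℂ) ^ 2) :
    ∀ x : ℝ, φ x = φ 0 + ((q ^ 3 / (1 + q ^ 2) : ℝ) : ℂ) * (x : ℂ) ^ 2 := by
  intro x
  have hq0 : 0 < q := by linarith
  have hr1 : q⁻¹ ^ 2 < 1 := pow_lt_one₀ (by positivity) (inv_lt_one_of_one_lt₀ hq) two_ne_zero
  have hc : q ^ 3 / (1 + q ^ 2) * (1 - (q⁻¹ ^ 2) ^ 2) = q - q⁻¹ := by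
    field_simp
    ring
  set c : ℝ := q ^ 3 / (1 + q ^ 2)
  have hψ := eq_apply_zero_of_forall_apply_mul_eq
    (ψ := fun y : ℝ => φ y - (c : ℂ) * (y : ℂ) ^ 2) (by positivity) hr1
    (hcont.sub (by fun_prop)) (fun y => by
      have h := hrec y
      rw [← hc] at h
      push_cast at h ⊢
      linear_combination -h) x
  simp only [Complex.ofReal_zero] at hψ
  linear_combination hψ
end

section
/- With respect to the Jackson-integral scalar product (g,f) = Σ_{n≥0} q^{−2n}·conj(g(ξ_n))·f(ξ_n) on the ξ-lattice ξ_n = q^{−2n−1}, the operator t⁺ is adjoint to q⁻²t⁻: for all f, g : ℝ → ℂ such that the families (q^{−2n}·conj(g(ξ_n))·(t⁺f)(ξ_n))_{n∈ℕ} and (q^{−2n}·conj((t⁻g)(ξ_n))·f(ξ_n))_{n∈ℕ} are summable, one has Σ_{n≥0} q^{−2n}·conj(g(ξ_n))·(t⁺f)(ξ_n) = q⁻²·Σ_{n≥0} q^{−2n}·conj((t⁻g)(ξ_n))·f(ξ_n). -/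
open Complex

/-- Radial part of `t⁺`: `(t⁺f)(ξ) = (1/(qλξ))·√(1−q⁻²ξ²)·f(q⁻²ξ)`, `λ = q − q⁻¹`. -/
noncomputable def tpRad (q : ℝ) (f : ℝ → ℂ) : ℝ → ℂ :=
  fun ξ => ((1 / (q * (q - q⁻¹) * ξ) * Real.sqrt (1 - q⁻¹ ^ 2 * ξ ^ 2) : ℝ) : ℂ) *
    f (q⁻¹ ^ 2 * ξ)

/-- Radial part of `t⁻`: `(t⁻f)(ξ) = (q/(λξ))·√(1−q²ξ²)·f(q²ξ)`, `λ = q − q⁻¹`. -/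
noncomputable def tmRad (q : ℝ) (f : ℝ → ℂ) : ℝ → ℂ :=
  fun ξ => ((q / ((q - q⁻¹) * ξ) * Real.sqrt (1 - q ^ 2 * ξ ^ 2) : ℝ) : ℂ) *
    f (q ^ 2 * ξ)

/-- The point `ξ_{n+1}` of the lattice is `q⁻² ξ_n`. -/
theorem lattice_succ {q : ℝ} (hq : q ≠ 0) (n : ℕ) :
    q ^ (-(2 * ((n + 1 : ℕ) : ℤ)) - 1) = q⁻¹ ^ 2 * q ^ (-(2 * (n : ℤ)) - 1) := by
  rw [show -(2 * ((n + 1 : ℕ) : ℤ)) - 1 = -2 + (-(2 * (n : ℤ)) - 1) by push_cast; ring,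
    zpow_add₀ hq, zpow_neg, inv_pow]
  rfl

/-- `t⁻g` vanishes at the largest lattice point `ξ_0 = q⁻¹`. -/
theorem tmRad_inv {q : ℝ} (hq : q ≠ 0) (g : ℝ → ℂ) : tmRad q g q⁻¹ = 0 := by
  simp [tmRad, hq]

/-- The weighted matrix coefficients of `t⁺` from `ξ_{n+1}` to `ξ_n` and of `q⁻² t⁻` from `ξ_n` to
`ξ_{n+1}` agree. -/
theorem tpRad_tmRad_term {q : ℝ} (hq : q ≠ 0) (f g : ℝ → ℂ) (n : ℕ) :
    ((q ^ (-(2 * (n : ℤ))) : ℝ) : ℂ) *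
        (starRingEnd ℂ) (g (q ^ (-(2 * (n : ℤ)) - 1))) * tpRad q f (q ^ (-(2 * (n : ℤ)) - 1))
      = ((q⁻¹ ^ 2 : ℝ) : ℂ) * (((q ^ (-(2 * ((n + 1 : ℕ) : ℤ))) : ℝ) : ℂ) *
          (starRingEnd ℂ) (tmRad q g (q ^ (-(2 * ((n + 1 : ℕ) : ℤ)) - 1))) *
            f (q ^ (-(2 * ((n + 1 : ℕ) : ℤ)) - 1))) := by
  have hw : q ^ (-(2 * ((n + 1 : ℕ) : ℤ))) = q⁻¹ ^ 2 * q ^ (-(2 * (n : ℤ))) := by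
    rw [show -(2 * ((n + 1 : ℕ) : ℤ)) = -2 + -(2 * (n : ℤ)) by push_cast; ring,
      zpow_add₀ hq, zpow_neg, inv_pow]
    rfl
  rw [lattice_succ hq, hw]
  set x := q ^ (-(2 * (n : ℤ)) - 1)
  set w := q ^ (-(2 * (n : ℤ)))
  have harg : q ^ 2 * (q⁻¹ ^ 2 * x) = x := by field_simp
  have hsq : 1 - q ^ 2 * (q⁻¹ ^ 2 * x) ^ 2 = 1 - q⁻¹ ^ 2 * x ^ 2 := by field_simp
  have hcoef : w * (1 / (q * (q - q⁻¹) * x)) =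
      q⁻¹ ^ 2 * (q⁻¹ ^ 2 * w) * (q / ((q - q⁻¹) * (q⁻¹ ^ 2 * x))) := by
    rw [mul_assoc q, mul_left_comm _ (q⁻¹ ^ 2) x]
    generalize (q - q⁻¹) * x = y
    field_simp
  simp only [tpRad, tmRad, harg, hsq, map_mul, Complex.conj_ofReal]
  generalize √(1 - q⁻¹ ^ 2 * x ^ 2) = s
  have hcoefC := congrArg (fun r : ℝ => (r : ℂ)) hcoef
  simp only [Complex.ofReal_mul] at hcoefC ⊢
  linear_combination (s * (starRingEnd ℂ) (g x) * f (q⁻¹ ^ 2 * x)) * hcoefC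

/-- With respect to the Jackson scalar product on the lattice `ξ_n = q^{−2n−1}`,
the operator `t⁺` is adjoint to `q⁻²t⁻`:
`(g, t⁺f) = q⁻²·(t⁻g, f)`. -/
theorem tp_adjoint_tm (q : ℝ) (hq : 1 < q) (f g : ℝ → ℂ)
    (h1 : Summable (fun n : ℕ => ((q ^ (-(2 * (n : ℤ))) : ℝ) : ℂ) *
      (starRingEnd ℂ) (g (q ^ (-(2 * (n : ℤ)) - 1))) * tpRad q f (q ^ (-(2 * (n : ℤ)) - 1))))
    (h2 : Summable (fun n : ℕ => ((q ^ (-(2 * (n : ℤ))) : ℝ) : ℂ) *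
      (starRingEnd ℂ) (tmRad q g (q ^ (-(2 * (n : ℤ)) - 1))) * f (q ^ (-(2 * (n : ℤ)) - 1)))) :
    (∑' n : ℕ, ((q ^ (-(2 * (n : ℤ))) : ℝ) : ℂ) *
        (starRingEnd ℂ) (g (q ^ (-(2 * (n : ℤ)) - 1))) * tpRad q f (q ^ (-(2 * (n : ℤ)) - 1)))
      = ((q⁻¹ ^ 2 : ℝ) : ℂ) *
        ∑' n : ℕ, ((q ^ (-(2 * (n : ℤ))) : ℝ) : ℂ) *
          (starRingEnd ℂ) (tmRad q g (q ^ (-(2 * (n : ℤ)) - 1))) *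
            f (q ^ (-(2 * (n : ℤ)) - 1)) := by
  rw [h2.tsum_eq_zero_add, tsum_congr (tpRad_tmRad_term (by positivity) f g), tsum_mul_left]
  simp [tmRad_inv (show q ≠ 0 by positivity)]
end

section
/- The concrete K-operators satisfy the first two K-algebra relations for every parameter x ∈ ℝ and every phase θ ∈ ℝ: for all c : ℤ → ℂ and m ∈ ℤ, q²·(K³(K⁺c))(m) − q⁻²·(K⁺(K³c))(m) = (q+q⁻¹)·(K⁺c)(m) and −q⁻²·(K³(K⁻c))(m) + q²·(K⁻(K³c))(m) = (q+q⁻¹)·(K⁻c)(m). -/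
/-- `K³` on Fourier-mode sequences: `(K³c)(m) = (1/λ)·(1+(q^{−2m}x)²)·c(m)`, `λ = q − q⁻¹`. -/
noncomputable def K3op (q x : ℝ) (c : ℤ → ℂ) : ℤ → ℂ :=
  fun m => ((1 / (q - q⁻¹) * (1 + (q ^ (-(2 * m)) * x) ^ 2) : ℝ) : ℂ) * c m

/-- `K⁺` on Fourier-mode sequences:
`(K⁺c)(m) = (e^{iθ}/(q²−1))·√(1−q²(q^{−2m}x)²)·c(m−1)`. -/
noncomputable def Kpop (q x θ : ℝ) (c : ℤ → ℂ) : ℤ → ℂ :=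
  fun m => Complex.exp (θ * Complex.I) / ((q : ℂ) ^ 2 - 1) *
    ((Real.sqrt (1 - q ^ 2 * (q ^ (-(2 * m)) * x) ^ 2) : ℝ) : ℂ) * c (m - 1)

/-- `K⁻` on Fourier-mode sequences:
`(K⁻c)(m) = −(q²e^{−iθ}/(q²−1))·√(1−q⁻²(q^{−2m}x)²)·c(m+1)`. -/
noncomputable def Kmop (q x θ : ℝ) (c : ℤ → ℂ) : ℤ → ℂ :=
  fun m => -((q : ℂ) ^ 2 * Complex.exp (-θ * Complex.I) / ((q : ℂ) ^ 2 - 1)) *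
    ((Real.sqrt (1 - q⁻¹ ^ 2 * (q ^ (-(2 * m)) * x) ^ 2) : ℝ) : ℂ) * c (m + 1)

/-- The scalar identity behind both relations, with `y = q^{-2m}x` and either shift of `y`. -/
lemma K3_coeff_relation {q : ℝ} (hq : 1 < q) (y : ℝ) :
    q ^ 2 * (1 / (q - q⁻¹) * (1 + y ^ 2))
        - q⁻¹ ^ 2 * (1 / (q - q⁻¹) * (1 + (q ^ 2 * y) ^ 2)) = q + q⁻¹ := by
  have hq0 : q ≠ 0 := by positivity
  have hq1 : q ^ 2 - 1 ≠ 0 := by nlinarith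
  have hqinv : q - q⁻¹ = (q ^ 2 - 1) / q := by field_simp
  rw [hqinv]
  field_simp
  ring

/-- Lowering the mode by one multiplies `q^{-2m}x` by `q²`. -/
lemma zpow_mode_sub_one {q : ℝ} (hq : q ≠ 0) (x : ℝ) (m : ℤ) :
    q ^ (-(2 * (m - 1))) * x = q ^ 2 * (q ^ (-(2 * m)) * x) := by
  rw [show -(2 * (m - 1)) = 2 + -(2 * m) by ring, zpow_add₀ hq, mul_assoc]
  norm_cast

/-- The first two K-algebra relations:
`q²K³K⁺ − q⁻²K⁺K³ = (q+q⁻¹)K⁺` and `−q⁻²K³K⁻ + q²K⁻K³ = (q+q⁻¹)K⁻`. -/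
theorem K_algebra_first_two (q : ℝ) (hq : 1 < q) (x θ : ℝ) (c : ℤ → ℂ) (m : ℤ) :
    ((q ^ 2 : ℝ) : ℂ) * K3op q x (Kpop q x θ c) m
        - ((q⁻¹ ^ 2 : ℝ) : ℂ) * Kpop q x θ (K3op q x c) m
      = ((q + q⁻¹ : ℝ) : ℂ) * Kpop q x θ c m ∧
    -((q⁻¹ ^ 2 : ℝ) : ℂ) * K3op q x (Kmop q x θ c) m
        + ((q ^ 2 : ℝ) : ℂ) * Kmop q x θ (K3op q x c) m
      = ((q + q⁻¹ : ℝ) : ℂ) * Kmop q x θ c m := by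
  have hq0 : q ≠ 0 := by positivity
  have hplus := congrArg (Complex.ofReal) (K3_coeff_relation hq (q ^ (-(2 * m)) * x))
  have hminus := congrArg (Complex.ofReal) (K3_coeff_relation hq (q ^ (-(2 * (m + 1))) * x))
  rw [← zpow_mode_sub_one hq0] at hplus hminus
  rw [add_sub_cancel_right] at hminus
  rw [Complex.ofReal_sub, Complex.ofReal_mul, Complex.ofReal_mul (q⁻¹ ^ 2)] at hplus hminus
  constructor
  · linear_combination (norm := (simp only [K3op, Kpop]; ring)) Kpop q x θ c m * hplus
  · linear_combination (norm := (simp only [K3op, Kmop]; ring)) Kmop q x θ c m * hminus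
end

section
/- The coefficient functions h(y) = (e^{iθ}/(q²−1))·√(1−q²y²) and j(y) = −(q²e^{−iθ}/(q²−1))·√(1−q⁻²y²) of the K-operators satisfy the third K-algebra relation in scalar form: for every real y with |y| ≤ q⁻¹, q⁻¹·h(y)·j(q²y) − q·j(y)·h(q⁻²y) = (1/λ)·(1 + y²). -/
/-- Coefficient function of `K⁺`: `h(y) = (e^{iθ}/(q²−1))·√(1−q²y²)`. -/
noncomputable def hCoeff (q θ : ℝ) (y : ℝ) : ℂ :=
  Complex.exp (θ * Complex.I) / ((q : ℂ) ^ 2 - 1) *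
    ((Real.sqrt (1 - q ^ 2 * y ^ 2) : ℝ) : ℂ)

/-- Coefficient function of `K⁻`: `j(y) = −(q²e^{−iθ}/(q²−1))·√(1−q⁻²y²)`. -/
noncomputable def jCoeff (q θ : ℝ) (y : ℝ) : ℂ :=
  -((q : ℂ) ^ 2 * Complex.exp (-θ * Complex.I) / ((q : ℂ) ^ 2 - 1)) *
    ((Real.sqrt (1 - q⁻¹ ^ 2 * y ^ 2) : ℝ) : ℂ)

/-- The third K-algebra relation in scalar form: for `|y| ≤ q⁻¹`,
`q⁻¹·h(y)·j(q²y) − q·j(y)·h(q⁻²y) = (1/λ)·(1 + y²)` with `λ = q − q⁻¹`. -/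
theorem K_algebra_third (q : ℝ) (hq : 1 < q) (θ : ℝ) (y : ℝ) (hy : |y| ≤ q⁻¹) :
    ((q⁻¹ : ℝ) : ℂ) * hCoeff q θ y * jCoeff q θ (q ^ 2 * y)
        - (q : ℂ) * jCoeff q θ y * hCoeff q θ (q⁻¹ ^ 2 * y)
      = ((1 / (q - q⁻¹) : ℝ) : ℂ) * (1 + (y : ℂ) ^ 2) := by
  have hq0 : 0 < q := by linarith
  have hq_sq : 1 < q ^ 2 := by nlinarith
  have hqC : (q : ℂ) ≠ 0 := by exact_mod_cast hq0.ne'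
  have hdC : (q : ℂ) ^ 2 - 1 ≠ 0 := by
    have hd : q ^ 2 - 1 ≠ 0 := by linarith
    exact_mod_cast hd
  have hy_sq : y ^ 2 ≤ q⁻¹ ^ 2 := sq_le_sq' (abs_le.mp hy).1 (abs_le.mp hy).2
  have h_inv : q⁻¹ ^ 2 ≤ 1 := pow_le_one₀ (by positivity) (inv_le_one_of_one_le₀ hq.le)
  have h_up : 0 ≤ 1 - q ^ 2 * y ^ 2 := by
    have h := mul_le_mul_of_nonneg_left hy_sq (sq_nonneg q)
    rw [← mul_pow q q⁻¹, mul_inv_cancel₀ hq0.ne'] at h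
    linarith
  have h_down : 0 ≤ 1 - q⁻¹ ^ 2 * y ^ 2 := by
    nlinarith [mul_le_mul h_inv (hy_sq.trans h_inv) (sq_nonneg y) zero_le_one]
  have e_up : 1 - q⁻¹ ^ 2 * (q ^ 2 * y) ^ 2 = 1 - q ^ 2 * y ^ 2 := by field_simp
  have e_down : 1 - q ^ 2 * (q⁻¹ ^ 2 * y) ^ 2 = 1 - q⁻¹ ^ 2 * y ^ 2 := by field_simp
  have s_up : ((√(1 - q ^ 2 * y ^ 2) : ℝ) : ℂ) ^ 2 = 1 - (q : ℂ) ^ 2 * (y : ℂ) ^ 2 := by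
    exact_mod_cast Real.sq_sqrt h_up
  have s_down : ((√(1 - q⁻¹ ^ 2 * y ^ 2) : ℝ) : ℂ) ^ 2 = 1 - (q : ℂ)⁻¹ ^ 2 * (y : ℂ) ^ 2 := by
    exact_mod_cast Real.sq_sqrt h_down
  have h_exp : Complex.exp (θ * Complex.I) * Complex.exp (-θ * Complex.I) = 1 := by
    rw [← Complex.exp_add]
    simp
  have h_lam : ((1 / (q - q⁻¹) : ℝ) : ℂ) = q / ((q : ℂ) ^ 2 - 1) := by
    have h : (q : ℂ) - (q : ℂ)⁻¹ = ((q : ℂ) ^ 2 - 1) / q := by field_simp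
    push_cast
    rw [h, one_div_div]
  unfold hCoeff jCoeff
  rw [e_up, e_down, h_lam, Complex.ofReal_inv]
  generalize Complex.exp (θ * Complex.I) = a at *
  generalize Complex.exp (-θ * Complex.I) = b at *
  generalize ((√(1 - q ^ 2 * y ^ 2) : ℝ) : ℂ) = s at *
  generalize ((√(1 - q⁻¹ ^ 2 * y ^ 2) : ℝ) : ℂ) = t at *
  calc
    _ = (q : ℂ) ^ 2 * ((q : ℂ) ^ 2 - 1)⁻¹ ^ 2 * (a * b) * (q * t ^ 2 - (q : ℂ)⁻¹ * s ^ 2) := by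
      ring
    _ = _ := by
      rw [h_exp, s_up, s_down]
      field_simp
      ring
end

section
/- With respect to the scalar product (c,d) = Σ_{m≥m_t} conj(c(m))·d(m) on sequences supported on modes m ≥ m_t, and for lattice parameter x = q^{2m_t−1} (m_t ∈ ℤ, m_t ≤ 0), the adjoint of K⁺ is −q⁻²K⁻: for all c, d : ℤ → ℂ with d(m) = 0 for all m < m_t, such that the families (conj(c(m))·(K⁺d)(m))_{m≥m_t} and (conj((K⁻c)(m))·d(m))_{m≥m_t} are summable, one has Σ_{m≥m_t} conj(c(m))·(K⁺d)(m) = −q⁻²·Σ_{m≥m_t} conj((K⁻c)(m))·d(m). -/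
/-- The termwise form of the adjointness of `K⁺` and `−q⁻²K⁻`. -/
theorem conj_mul_Kpop_succ {q : ℝ} (hq : q ≠ 0) (x θ : ℝ) (c d : ℤ → ℂ) (m : ℤ) :
    (starRingEnd ℂ) (c (m + 1)) * Kpop q x θ d (m + 1)
      = -((q⁻¹ ^ 2 : ℝ) : ℂ) * ((starRingEnd ℂ) (Kmop q x θ c m) * d m) := by
  have hqC : (q : ℂ) ≠ 0 := by exact_mod_cast hq
  have hsqrt : q ^ 2 * (q ^ (-(2 * (m + 1))) * x) ^ 2 = q⁻¹ ^ 2 * (q ^ (-(2 * m)) * x) ^ 2 := by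
    have hpow : q ^ (-(2 * (m + 1))) = q ^ (-(2 * m)) * q⁻¹ ^ 2 := by
      rw [show -(2 * (m + 1)) = -(2 * m) + (-2) by ring, zpow_add₀ hq, zpow_neg, inv_pow]
      norm_cast
    rw [hpow]
    field_simp
  have hexp : (starRingEnd ℂ) (Complex.exp (-θ * Complex.I)) = Complex.exp (θ * Complex.I) := by
    rw [← Complex.exp_conj]
    simp
  simp only [Kpop, Kmop, hsqrt, add_sub_cancel_right, map_mul, map_neg, map_div₀, map_sub, map_pow,
    map_one, Complex.conj_ofReal, hexp]
  push_cast
  field_simp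

/-- With respect to the scalar product `(c,d) = Σ_{m ≥ m_t} conj(c(m))·d(m)` and lattice
parameter `x = q^{2m_t−1}` (`m_t ≤ 0`), the adjoint of `K⁺` is `−q⁻²K⁻`. -/
theorem Kp_adjoint (q : ℝ) (hq : 1 < q) (θ : ℝ) (mt : ℤ) (hmt : mt ≤ 0)
    (c d : ℤ → ℂ) (hd : ∀ m : ℤ, m < mt → d m = 0)
    (h1 : Summable (fun n : ℕ =>
      (starRingEnd ℂ) (c (mt + n)) * Kpop q (q ^ (2 * mt - 1)) θ d (mt + n)))
    (h2 : Summable (fun n : ℕ =>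
      (starRingEnd ℂ) (Kmop q (q ^ (2 * mt - 1)) θ c (mt + n)) * d (mt + n))) :
    (∑' n : ℕ, (starRingEnd ℂ) (c (mt + n)) * Kpop q (q ^ (2 * mt - 1)) θ d (mt + n))
      = -((q⁻¹ ^ 2 : ℝ) : ℂ) *
        ∑' n : ℕ, (starRingEnd ℂ) (Kmop q (q ^ (2 * mt - 1)) θ c (mt + n)) * d (mt + n) := by
  have hq0 : q ≠ 0 := by positivity
  rw [h1.tsum_eq_zero_add, ← tsum_mul_left]
  have hzero : (starRingEnd ℂ) (c (mt + (0 : ℕ))) *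
      Kpop q (q ^ (2 * mt - 1)) θ d (mt + (0 : ℕ)) = 0 := by
    simp [Kpop, hd (mt - 1) (by lia)]
  rw [hzero, zero_add]
  refine tsum_congr fun n => ?_
  rw [Nat.cast_succ, ← add_assoc]
  exact conj_mul_Kpop_succ hq0 _ θ c d (mt + n)
end

section
/- The q → 1 limit of the raising operator T⁺_orb exists (with phase e^{iθ} = −1) and reproduces the classical angular momentum raising operator: for every ξ with 0 < ξ < 1, every integer m, and every g : ℝ → ℂ that is differentiable at ξ and continuous on a neighborhood of ξ, the expression (1/(q·(q−q⁻¹)·ξ))·( √(1−q⁻²ξ²)·g(q⁻²ξ) − √(1−q^{−4m−2}ξ²)·g(ξ) ) tends to −√(1−ξ²)·g′(ξ) − (m·ξ/√(1−ξ²))·g(ξ) as q tends to 1 from the right. (The two terms of T⁺_orb have no individual limit; only their combination with e^{iθ} = −1 does.) -/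
/-- The `q → 1⁺` limit of the raising operator `T⁺_orb` (with phase `e^{iθ} = −1`)
reproduces the classical angular momentum raising operator: on the mode `m`, for
`0 < ξ < 1` and `g` differentiable at `ξ` and continuous on a neighborhood of `ξ`,
`(1/(q(q−q⁻¹)ξ))·(√(1−q⁻²ξ²)·g(q⁻²ξ) − √(1−q^{−4m−2}ξ²)·g(ξ))`
tends to `−√(1−ξ²)·g′(ξ) − (mξ/√(1−ξ²))·g(ξ)`. -/
theorem Tporb_classical_limit (ξ : ℝ) (hξ0 : 0 < ξ) (hξ1 : ξ < 1) (m : ℤ)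
    (g : ℝ → ℂ) (hdiff : DifferentiableAt ℝ g ξ)
    (hcont : ∃ U ∈ nhds ξ, ContinuousOn g U) :
    Filter.Tendsto
      (fun q : ℝ =>
        ((1 / (q * (q - q⁻¹) * ξ) : ℝ) : ℂ) *
          (((Real.sqrt (1 - q⁻¹ ^ 2 * ξ ^ 2) : ℝ) : ℂ) * g (q⁻¹ ^ 2 * ξ)
            - ((Real.sqrt (1 - q ^ (-(4 * m) - 2) * ξ ^ 2) : ℝ) : ℂ) * g ξ))
      (nhdsWithin 1 (Set.Ioi 1))
      (nhds (-((Real.sqrt (1 - ξ ^ 2) : ℝ) : ℂ) * deriv g ξ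
        - (((m : ℝ) * ξ / Real.sqrt (1 - ξ ^ 2) : ℝ) : ℂ) * g ξ)) := by
  have hs : 0 < 1 - ξ ^ 2 := by nlinarith
  have hs' : 0 < Real.sqrt (1 - ξ ^ 2) := Real.sqrt_pos.2 hs
  have hinv : HasDerivAt (fun q : ℝ => q⁻¹ ^ 2) (-2) 1 :=
    ((hasDerivAt_inv (one_ne_zero (α := ℝ))).fun_pow 2).congr_deriv (by norm_num)
  have hsqrt₁ : HasDerivAt (fun q : ℝ => Real.sqrt (1 - q⁻¹ ^ 2 * ξ ^ 2))
      (ξ ^ 2 / Real.sqrt (1 - ξ ^ 2)) 1 := by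
    refine (((hinv.mul_const (ξ ^ 2)).const_sub 1).sqrt (by simpa using hs.ne')).congr_deriv ?_
    norm_num
    field_simp
  have hsqrt₂ : HasDerivAt (fun q : ℝ => Real.sqrt (1 - q ^ (-(4 * m) - 2) * ξ ^ 2))
      ((2 * m + 1) * ξ ^ 2 / Real.sqrt (1 - ξ ^ 2)) 1 := by
    have hz := hasDerivAt_zpow (-(4 * m) - 2) (1 : ℝ) (Or.inl one_ne_zero)
    refine (((hz.mul_const (ξ ^ 2)).const_sub 1).sqrt (by simpa using hs.ne')).congr_deriv ?_
    simp only [one_zpow]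
    push_cast
    field_simp
    ring
  have hg : HasDerivAt (fun q : ℝ => g (q⁻¹ ^ 2 * ξ)) ((-2 * ξ : ℝ) • deriv g ξ) 1 :=
    HasDerivAt.scomp (h := fun q : ℝ => q⁻¹ ^ 2 * ξ) (1 : ℝ)
      (by simpa using hdiff.hasDerivAt) (hinv.mul_const ξ)
  have hF := (hsqrt₁.ofReal_comp.mul hg).sub (hsqrt₂.ofReal_comp.mul_const (g ξ))
  have hpre : Filter.Tendsto (fun q : ℝ => ((1 / ((q + 1) * ξ) : ℝ) : ℂ))
      (nhdsWithin 1 (Set.Ioi 1)) (nhds ((1 / ((1 + 1) * ξ) : ℝ) : ℂ)) := by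
    have hc : ContinuousAt (fun q : ℝ => 1 / ((q + 1) * ξ)) 1 :=
      ContinuousAt.div (by fun_prop) (by fun_prop) (by positivity)
    exact (Complex.continuous_ofReal.continuousAt.comp hc).tendsto.mono_left nhdsWithin_le_nhds
  have hslope := hF.tendsto_slope.mono_left
    (nhdsWithin_mono (1 : ℝ) (fun q (hq : q ∈ Set.Ioi 1) => ne_of_gt hq))
  refine ((hpre.mul hslope).congr' ?_).trans_eq ?_
  · filter_upwards [self_mem_nhdsWithin] with q hq
    have hq1 : 1 < q := hq
    have hcoef : 1 / (q * (q - q⁻¹) * ξ) = 1 / ((q + 1) * ξ) * (q - 1)⁻¹ := by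
      have h₁ : q - 1 ≠ 0 := by linarith
      have h₂ : q + 1 ≠ 0 := by linarith
      have h₃ : q * (q - q⁻¹) = (q + 1) * (q - 1) := by
        field_simp
        ring
      rw [h₃]
      field_simp
    rw [hcoef, slope_def_module]
    simp [mul_assoc]
  · have hsC : ((Real.sqrt (1 - ξ ^ 2) : ℝ) : ℂ) ≠ 0 := by exact_mod_cast hs'.ne'
    have hξC : (ξ : ℂ) ≠ 0 := by exact_mod_cast hξ0.ne'
    congr 1
    simp only [inv_one, one_pow, one_mul, Complex.real_smul]
    push_cast
    field_simp
    ring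
end
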